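/- Let d ≥ 1 and let K ⊆ ℝ^d be a convex set with closedBall(0, r) ⊆ K ⊆ closedBall(0, R) for some 0 < r ≤ R. Then for every x ∈ K and every s with 0 < s ≤ r, the Lebesgue volume of K ∩ closedBall(x, s) is at least (1/√(2πd))·(r/(√2·R))^{d−1} times the Lebesgue volume of closedBall(x, s). -/

import Mathlib

open MeasureTheory

/-- Volume of the unit ball in dimension n. -/
noncomputable def kap (n : ℕ) : ℝ := Real.sqrt Real.pi ^ n / Real.Gamma (n / 2 + 1)

lemma kap_pos (n : ℕ) : 0 < kap n := by
  unfold kap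
  have : 0 < Real.Gamma ((n:ℝ) / 2 + 1) := Real.Gamma_pos_of_pos (by positivity)
  have := Real.pi_pos
  positivity

lemma vol_cb (n : ℕ) (x : EuclideanSpace ℝ (Fin n)) (r : ℝ) (hr : 0 ≤ r) :
    volume (Metric.closedBall x r) = ENNReal.ofReal (r ^ n * kap n) := by
  rcases Nat.eq_zero_or_pos n with rfl | hn
  · have e : Metric.closedBall x r = Set.univ := by
      ext y
      simpa [Subsingleton.elim y x] using hr
    have := (PiLp.volume_preserving_toLp (Fin 0)).measure_preimage
      (s := Set.univ) MeasurableSet.univ.nullMeasurableSet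
    rw [e, ← this, Set.preimage_univ, volume_pi, Measure.pi_of_empty]
    simp [kap]
  have : Nonempty (Fin n) := ⟨⟨0, hn⟩⟩
  rw [EuclideanSpace.volume_closedBall, ENNReal.ofReal_mul (by positivity), ENNReal.ofReal_pow hr]
  simp [kap]

lemma kap_ratio (n : ℕ) :
    (Real.sqrt (2 * Real.pi * ((n + 1 : ℕ) : ℝ)))⁻¹ * kap (n + 1) ≤ kap n / (n + 1) := by
  set a : ℝ := ((n:ℝ) + 1) / 2 with ha
  have ha0 : 0 < a := by positivity
  have hG1 : 0 < Real.Gamma (a + 1/2) := Real.Gamma_pos_of_pos (by positivity)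
  have hG2 : 0 < Real.Gamma a := Real.Gamma_pos_of_pos (by positivity)
  have key := Real.Gamma_mul_add_mul_le_rpow_Gamma_mul_rpow_Gamma (s := a) (t := a + 1)
    (a := 1/2) (b := 1/2) ha0 (by positivity) (by norm_num) (by norm_num) (by norm_num)
  rw [show (1/2 : ℝ) * a + 1/2 * (a+1) = a + 1/2 by ring, Real.Gamma_add_one ha0.ne',
    ← Real.sqrt_eq_rpow, ← Real.sqrt_eq_rpow, Real.sqrt_mul ha0.le] at key
  have h1 : Real.Gamma (a + 1/2) ≤ Real.sqrt a * Real.Gamma a := by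
    calc _ ≤ _ := key
      _ = Real.sqrt a * (Real.sqrt (Real.Gamma a) * Real.sqrt (Real.Gamma a)) := by ring
      _ = _ := by rw [Real.mul_self_sqrt hG2.le]
  have e1 : kap (n+1) = Real.sqrt Real.pi ^ (n+1) / (a * Real.Gamma a) := by
    unfold kap
    rw [← Real.Gamma_add_one ha0.ne']; push_cast; rfl
  have e2 : kap n = Real.sqrt Real.pi ^ n / Real.Gamma (a + 1/2) := by
    unfold kap
    congr 2; rw [ha]; ring
  have e3 : Real.sqrt (2 * Real.pi * ((n + 1 : ℕ) : ℝ)) = 2 * Real.sqrt Real.pi * Real.sqrt a := by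
    rw [show 2 * Real.pi * ((n + 1 : ℕ) : ℝ) = 2^2 * Real.pi * a by push_cast; rw [ha]; ring,
      Real.sqrt_mul (by positivity), Real.sqrt_mul (by positivity), Real.sqrt_sq (by norm_num)]
  rw [e1, e2, e3, show (n:ℝ)+1 = 2 * a by rw [ha]; ring]
  have hp : 0 < Real.sqrt Real.pi := Real.sqrt_pos.2 Real.pi_pos
  have hs : 0 < Real.sqrt a := Real.sqrt_pos.2 ha0
  have : (2 * Real.sqrt Real.pi * Real.sqrt a)⁻¹ * (Real.sqrt Real.pi ^ (n+1) / (a * Real.Gamma a))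
     = Real.sqrt Real.pi ^ n / (2 * a) * (1 / (Real.sqrt a * Real.Gamma a)) := by
    field_simp
    ring
  rw [this, show Real.sqrt Real.pi ^ n / Real.Gamma (a + 1/2) / (2 * a) =
    Real.sqrt Real.pi ^ n / (2 * a) * (1 / Real.Gamma (a + 1/2)) by field_simp]
  gcongr

lemma exists_F (n : ℕ) (u : EuclideanSpace ℝ (Fin (n+1))) (hu : ‖u‖ = 1) :
    ∃ F : EuclideanSpace ℝ (Fin (n+1)) → ℝ × EuclideanSpace ℝ (Fin n),
      MeasurePreserving F volume volume ∧ ∀ y, (F y).1 = inner ℝ u y ∧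
        ‖y‖ ^ 2 = (F y).1 ^ 2 + ‖(F y).2‖ ^ 2 := by
  have hv : Orthonormal ℝ (({0} : Set (Fin (n+1))).domRestrict (fun _ => u)) := by
    constructor
    · intro i; simpa using hu
    · intro i j hij
      exact absurd (Subsingleton.elim i j) hij
  obtain ⟨b, hb⟩ := hv.exists_orthonormalBasis_extension_of_card_eq (by simp)
  have hb0 : b 0 = u := hb 0 rfl
  refine ⟨fun y => (b.repr y 0, WithLp.toLp 2 (fun i : Fin n => b.repr y i.succ)), ?_, ?_⟩
  · have h1 := b.measurePreserving_repr
    have h2 := PiLp.volume_preserving_ofLp (Fin (n+1))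
    have h3 := volume_preserving_piFinSuccAbove (fun _ : Fin (n+1) => ℝ) 0
    have h4 := (MeasurePreserving.id (volume : Measure ℝ)).prod (PiLp.volume_preserving_toLp (Fin n))
    have := h4.comp (h3.comp (h2.comp h1))
    exact this
  · intro y
    refine ⟨by simp [b.repr_apply_apply, hb0], ?_⟩
    rw [← b.repr.norm_map y, EuclideanSpace.norm_sq_eq, EuclideanSpace.norm_sq_eq,
      Fin.sum_univ_succ]
    simp

/-- Double cone. -/
def dc (n : ℕ) (h s ρ : ℝ) : Set (ℝ × EuclideanSpace ℝ (Fin n)) :=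
  {p | 0 < p.1 ∧ p.1 ≤ h ∧ ‖p.2‖ ≤ ρ * (p.1 / h)} ∪
  {p | h < p.1 ∧ p.1 < s ∧ ‖p.2‖ ≤ ρ * ((s - p.1) / (s - h))}

lemma meas_dc (n : ℕ) (h s ρ : ℝ) : MeasurableSet (dc n h s ρ) := by
  unfold dc
  have m1 : Measurable (fun p : ℝ × EuclideanSpace ℝ (Fin n) => p.1) := measurable_fst
  have m2 : Measurable (fun p : ℝ × EuclideanSpace ℝ (Fin n) => ‖p.2‖) := measurable_snd.norm
  refine MeasurableSet.union ?_ ?_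
  · exact (measurableSet_lt measurable_const m1).inter ((measurableSet_le m1 measurable_const).inter
      (measurableSet_le m2 (by fun_prop)))
  · exact (measurableSet_lt measurable_const m1).inter ((measurableSet_lt m1 measurable_const).inter
      (measurableSet_le m2 (by fun_prop)))

lemma vol_dc (n : ℕ) (h s ρ : ℝ) (hh : 0 < h) (hs : h < s) (hρ : 0 ≤ ρ) :
    ENNReal.ofReal (ρ ^ n * s * (kap n / (n + 1))) ≤ volume (dc n h s ρ) := by
  have hk := kap_pos n
  rw [Measure.volume_eq_prod, Measure.prod_apply (meas_dc n h s ρ)]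
  have hA : ∫⁻ t in Set.Ioc 0 h, volume (Prod.mk t ⁻¹' dc n h s ρ) =
      ENNReal.ofReal (ρ ^ n * h * (kap n / (n + 1))) := by
    have : ∀ t ∈ Set.Ioc 0 h, volume (Prod.mk t ⁻¹' dc n h s ρ) =
        ENNReal.ofReal ((ρ * (t / h)) ^ n * kap n) := by
      intro t ht
      have h0 := ht.1
      rw [← vol_cb n 0 _ (by positivity)]
      congr 1
      ext w
      have := ht.2
      simp [dc, ht.1, ht.2, this.not_gt]
    rw [setLIntegral_congr_fun measurableSet_Ioc this, ← ofReal_integral_eq_lintegral_ofReal,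
      ← intervalIntegral.integral_of_le hh.le]
    · congr 1
      have : ∀ t : ℝ, (ρ * (t / h)) ^ n * kap n = t ^ n * (ρ ^ n / h ^ n * kap n) := by
        intro t; rw [mul_pow, div_pow]; ring
      simp_rw [this]
      rw [intervalIntegral.integral_mul_const, integral_pow]
      field_simp
      simp
      ring
    · exact Continuous.integrableOn_Ioc (by fun_prop)
    · filter_upwards [ae_restrict_mem measurableSet_Ioc] with t ht
      have h0 := ht.1
      simp only [Pi.zero_apply]; positivity
  have hB : ∫⁻ t in Set.Ioo h s, volume (Prod.mk t ⁻¹' dc n h s ρ) =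
      ENNReal.ofReal (ρ ^ n * (s - h) * (kap n / (n + 1))) := by
    have hsh : 0 < s - h := sub_pos.2 hs
    have : ∀ t ∈ Set.Ioo h s, volume (Prod.mk t ⁻¹' dc n h s ρ) =
        ENNReal.ofReal ((ρ * ((s - t) / (s - h))) ^ n * kap n) := by
      intro t ht
      have h0 : 0 < s - t := sub_pos.2 ht.2
      rw [← vol_cb n 0 _ (by positivity)]
      congr 1
      ext w
      have := ht.1
      simp [dc, ht.1, ht.2, this.not_ge]
    rw [setLIntegral_congr_fun measurableSet_Ioo this, restrict_Ioo_eq_restrict_Ioc,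
      ← ofReal_integral_eq_lintegral_ofReal, ← intervalIntegral.integral_of_le hs.le]
    · congr 1
      have : ∀ t : ℝ, (ρ * ((s - t) / (s - h))) ^ n * kap n =
          (s - t) ^ n * (ρ ^ n / (s - h) ^ n * kap n) := by
        intro t; rw [mul_pow, div_pow]; ring
      simp_rw [this]
      rw [intervalIntegral.integral_mul_const,
        intervalIntegral.integral_comp_sub_left (fun t => t ^ n) s, integral_pow]
      field_simp
      simp
      ring
    · exact Continuous.integrableOn_Ioc (by fun_prop)
    · filter_upwards [ae_restrict_mem measurableSet_Ioc] with t ht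
      have h0 : 0 ≤ s - t := sub_nonneg.2 ht.2
      simp only [Pi.zero_apply]; positivity
  calc _ = ENNReal.ofReal (ρ ^ n * h * (kap n / (n + 1))) +
        ENNReal.ofReal (ρ ^ n * (s - h) * (kap n / (n + 1))) := by
        have hsh : 0 < s - h := sub_pos.2 hs
        rw [← ENNReal.ofReal_add (by positivity) (by positivity)]
        congr 1; ring
    _ = ∫⁻ t in Set.Ioc 0 h ∪ Set.Ioo h s, volume (Prod.mk t ⁻¹' dc n h s ρ) := by
        rw [lintegral_union measurableSet_Ioo, hA, hB]
        rw [Set.disjoint_left]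
        intro t h1 h2
        exact absurd h1.2 (not_le.2 h2.1)
    _ ≤ _ := setLIntegral_le_lintegral _ _

lemma incl (n : ℕ) (C : Set (EuclideanSpace ℝ (Fin (n+1)))) (hC : Convex ℝ C)
    (u : EuclideanSpace ℝ (Fin (n+1))) (hu : ‖u‖ = 1) (h s ρ : ℝ) (hh : 0 < h) (hs : h < s)
    (h0 : 0 ∈ C) (hsu : s • u ∈ C)
    (hw : ∀ w, inner ℝ u w = 0 → ‖w‖ ≤ ρ → h • u + w ∈ C)
    (z : EuclideanSpace ℝ (Fin (n+1))) (p : ℝ × EuclideanSpace ℝ (Fin n))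
    (hp1 : p.1 = inner ℝ u z) (hp2 : ‖z‖ ^ 2 = p.1 ^ 2 + ‖p.2‖ ^ 2) (hp : p ∈ dc n h s ρ) :
    z ∈ C := by
  set w := z - p.1 • u with hwdef
  have hwu : inner ℝ u w = 0 := by
    rw [hwdef, inner_sub_right, inner_smul_right, real_inner_self_eq_norm_sq, hu, hp1]; ring
  have hz : z = p.1 • u + w := by rw [hwdef]; abel
  have hn : ‖w‖ = ‖p.2‖ := by
    have : ‖w‖ ^ 2 = ‖p.2‖ ^ 2 := by
      rw [hwdef, norm_sub_sq_real, hp2, inner_smul_right, real_inner_comm, ← hp1, norm_smul, hu]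
      simp only [Real.norm_eq_abs, mul_one, sq_abs]; ring
    exact (sq_eq_sq₀ (norm_nonneg _) (norm_nonneg _)).1 this
  have main : ∀ l : ℝ, 0 < l → l ≤ 1 → ‖w‖ ≤ ρ * l → ∀ q ∈ C,
      l • (h • u + l⁻¹ • w) + (1 - l) • q ∈ C := by
    intro l hl hl1 hwl q hq
    refine hC (hw _ ?_ ?_) hq hl.le (by linarith) (by ring)
    · rw [inner_smul_right, hwu, mul_zero]
    · rw [norm_smul, norm_inv, Real.norm_of_nonneg hl.le, inv_mul_le_iff₀ hl]; linarith
  rcases hp with ⟨a1, a2, a3⟩ | ⟨a1, a2, a3⟩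
  · have hl : 0 < p.1 / h := by positivity
    have := main (p.1 / h) hl ((div_le_one hh).2 a2) (hn ▸ a3) 0 h0
    convert this using 1
    rw [smul_add, smul_smul, smul_smul, mul_inv_cancel₀ hl.ne', div_mul_cancel₀ _ hh.ne']
    simpa using hz
  · have hsh : 0 < s - h := sub_pos.2 hs
    have hl : 0 < (s - p.1) / (s - h) := div_pos (sub_pos.2 a2) hsh
    have := main ((s - p.1) / (s - h)) hl ((div_le_one hsh).2 (by linarith)) (hn ▸ a3) _ hsu
    convert this using 1
    rw [smul_add, smul_smul, smul_smul, mul_inv_cancel₀ hl.ne', smul_smul, one_smul,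
      add_right_comm, ← add_smul]
    conv_lhs => rw [hz]
    congr 2
    field_simp
    ring

/-- If `closedBall 0 r ⊆ K ⊆ closedBall 0 R` with `K ⊆ ℝ^d` convex, then for every
`x ∈ K` and `0 < s ≤ r`, the volume of `K ∩ closedBall x s` is at least
`(1/√(2πd))·(r/(√2 R))^{d−1}` times the volume of `closedBall x s`. -/
theorem stmt_6 (d : ℕ) (hd : 1 ≤ d) (K : Set (EuclideanSpace ℝ (Fin d)))
    (hK : Convex ℝ K) (r R : ℝ) (hr : 0 < r) (hrR : r ≤ R)
    (hK1 : Metric.closedBall 0 r ⊆ K) (hK2 : K ⊆ Metric.closedBall 0 R) :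
    ∀ x ∈ K, ∀ s : ℝ, 0 < s → s ≤ r →
      ENNReal.ofReal ((Real.sqrt (2 * Real.pi * d))⁻¹ * (r / (Real.sqrt 2 * R)) ^ (d - 1)) *
          volume (Metric.closedBall x s) ≤
        volume (K ∩ Metric.closedBall x s) := by
  intro x hx s hs hsr
  obtain ⟨n, rfl⟩ : ∃ n, d = n + 1 := ⟨d - 1, by omega⟩
  have hR : 0 < R := hr.trans_le hrR
  have hxR : ‖x‖ ≤ R := by simpa using hK2 hx
  obtain ⟨u, hu, hxu⟩ : ∃ u : EuclideanSpace ℝ (Fin (n+1)), ‖u‖ = 1 ∧ x = ‖x‖ • u := by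
    by_cases h0 : x = 0
    · exact ⟨EuclideanSpace.single 0 1, by simp, by simp [h0]⟩
    · have : ‖x‖ ≠ 0 := norm_ne_zero_iff.2 h0
      refine ⟨‖x‖⁻¹ • x, ?_, ?_⟩
      · rw [norm_smul, norm_inv, norm_norm, inv_mul_cancel₀ this]
      · rw [smul_smul, mul_inv_cancel₀ this, one_smul]
  set l := ‖x‖ with hl
  have hl0 : 0 ≤ l := norm_nonneg x
  have h2 : 0 < Real.sqrt 2 := by positivity
  have h22 : Real.sqrt 2 ^ 2 = 2 := Real.sq_sqrt (by norm_num)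
  set h := s / Real.sqrt 2 with hh
  have hh0 : 0 < h := by positivity
  have hh2 : 2 * h ^ 2 = s ^ 2 := by rw [hh, div_pow, h22]; ring
  have hhs : h < s := by nlinarith
  set ρ := h * (r / R) with hρ
  have hρ0 : 0 < ρ := by positivity
  have hρh : ρ ≤ h := by
    rw [hρ]; exact mul_le_of_le_one_right hh0.le ((div_le_one hR).2 hrR)
  have h0K : (0 : EuclideanSpace ℝ (Fin (n+1))) ∈ K := hK1 (by simpa using hr.le)
  have pyth : ∀ (a : ℝ) (w : EuclideanSpace ℝ (Fin (n+1))), inner ℝ u w = 0 →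
      ‖a • u + w‖ ^ 2 = a ^ 2 + ‖w‖ ^ 2 := by
    intro a w hw
    rw [norm_add_sq_real, inner_smul_left, hw, norm_smul, hu]; simp
  set C : Set (EuclideanSpace ℝ (Fin (n+1))) := {z | x - z ∈ K ∧ ‖z‖ ≤ s} with hCdef
  have hC : Convex ℝ C := by
    intro a ha b hb p q hp hq hpq
    refine ⟨?_, ?_⟩
    · have := hK ha.1 hb.1 hp hq hpq
      convert this using 1
      have : x = (p + q) • x := by rw [hpq, one_smul]
      conv_lhs => rw [this]
      module
    · have := (convex_closedBall (0 : EuclideanSpace ℝ (Fin (n+1))) s)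
        (by simpa using ha.2) (by simpa using hb.2) hp hq hpq
      simpa using this
  have hC0 : (0 : EuclideanSpace ℝ (Fin (n+1))) ∈ C := ⟨by simpa using hx, by simpa using hs.le⟩
  have hCs : s • u ∈ C := by
    refine ⟨?_, by rw [norm_smul, hu, Real.norm_of_nonneg hs.le, mul_one]⟩
    rcases le_total l r with h1 | h1
    · apply hK1
      rw [mem_closedBall_zero_iff, hxu, ← sub_smul, norm_smul, hu, mul_one, Real.norm_eq_abs,
        abs_le]
      constructor <;> linarith
    · have hlp : 0 < l := hr.trans_le h1
      have := hK hx h0K (a := 1 - s / l) (b := s / l)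
        (sub_nonneg.2 ((div_le_one hlp).2 (hsr.trans h1))) (by positivity) (by ring)
      convert this using 1
      rw [smul_zero, add_zero, hxu, smul_smul, ← sub_smul]
      congr 1
      field_simp
  have hCw : ∀ w, inner ℝ u w = 0 → ‖w‖ ≤ ρ → h • u + w ∈ C := by
    intro w hw hwρ
    have hwh : ‖w‖ ^ 2 ≤ h ^ 2 := by
      have := norm_nonneg w
      gcongr; exact hwρ.trans hρh
    refine ⟨?_, ?_⟩
    · rcases le_total l r with h1 | h1
      · apply hK1
        rw [mem_closedBall_zero_iff, hxu,
          show l • u - (h • u + w) = (l - h) • u + (-w) by module]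
        refine (sq_le_sq₀ (norm_nonneg _) hr.le).1 ?_
        rw [pyth _ _ (by rw [inner_neg_right, hw, neg_zero]), norm_neg]
        have e : s ≤ 2 * h := by nlinarith
        by_cases h3 : l ≤ 2 * h
        · nlinarith
        · push Not at h3
          nlinarith
      · have hlp : 0 < l := hr.trans_le h1
        have hhl : h ≤ l := by linarith
        have hm : (-(l / h)) • w ∈ K := by
          apply hK1
          rw [mem_closedBall_zero_iff, norm_smul, norm_neg, Real.norm_of_nonneg (by positivity)]
          calc l / h * ‖w‖ ≤ l / h * ρ := by gcongr
            _ = l * (r / R) := by rw [hρ]; field_simp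
            _ ≤ R * (r / R) := by gcongr
            _ = r := by field_simp
        have := hK hx hm (a := 1 - h / l) (b := h / l)
          (sub_nonneg.2 ((div_le_one hlp).2 hhl)) (by positivity) (by ring)
        convert this using 1
        rw [smul_smul, show h / l * -(l / h) = -1 by field_simp]
        have e : h • u = (h / l) • x := by
          conv_rhs => rw [hxu, smul_smul, div_mul_cancel₀ _ hlp.ne']
        rw [e]
        module
    · refine (sq_le_sq₀ (norm_nonneg _) hs.le).1 ?_
      rw [pyth _ _ hw]; linarith
  obtain ⟨F, hF, hF2⟩ := exists_F n u hu
  have hG : MeasurePreserving (fun y : EuclideanSpace ℝ (Fin (n+1)) => F (x - y)) volume volume :=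
    hF.comp (volume.measurePreserving_sub_left x)
  have hsub : (fun y => F (x - y)) ⁻¹' (dc n h s ρ) ⊆ K ∩ Metric.closedBall x s := by
    intro y hy
    have := incl n C hC u hu h s ρ hh0 hhs hC0 hCs hCw (x - y) (F (x - y)) (hF2 _).1 (hF2 _).2 hy
    refine ⟨by simpa using this.1, ?_⟩
    rw [Metric.mem_closedBall, dist_comm, dist_eq_norm]; exact this.2
  refine le_trans ?_ (measure_mono hsub)
  rw [hG.measure_preimage (meas_dc n h s ρ).nullMeasurableSet]
  refine le_trans ?_ (vol_dc n h s ρ hh0 hhs hρ0.le)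
  rw [vol_cb _ _ _ hs.le, ← ENNReal.ofReal_mul (by positivity)]
  apply ENNReal.ofReal_le_ofReal
  have hkr := kap_ratio n
  have e : ρ = s * (r / (Real.sqrt 2 * R)) := by rw [hρ, hh]; field_simp
  calc _ = ρ ^ n * s * ((Real.sqrt (2 * Real.pi * ((n + 1 : ℕ) : ℝ)))⁻¹ * kap (n + 1)) := by
        rw [e, mul_pow, Nat.add_sub_cancel]; ring
    _ ≤ _ := by gcongr
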